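/- arXiv:1005.5680 — 3 statements merged into one kernel-verified Lean document; each statement's English description precedes it below -/
import Mathlib

section
/- Let (R, E, [.,.], ρ, H) be an H-twisted Lie–Rinehart algebra and let Ψ be an alternating R-multilinear p-form on E with values in ker ρ such that (a) H(Ψ(φ₁,…,φ_p), ψ, χ) = 0 for all φ₁,…,φ_p,ψ,χ ∈ E, and (b) Ψ(H(ψ,χ,ω), φ₂,…,φ_p) = 0 for all ψ,χ,ω,φ₂,…,φ_p ∈ E. Then D(DΨ) = 0, where D is the exterior covariant derivative associated to the induced connection ∇ on ker ρ. In particular the naive differential squares to zero on the naive cochains with values in ker ρ, and if H = 0 (i.e. for a Lie–Rinehart algebra) then D² = 0 on all ker ρ-valued forms. -/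
section
variable {E : Type*} [AddCommGroup E]

/-- The exterior covariant derivative on `ker ρ`-valued alternating `p`-forms on `E`,
associated to the induced connection `∇_φ ψ = [φ,ψ]`:
`DΨ(ψ₀,…,ψ_p) = Σᵢ (−1)ⁱ ∇_{ψᵢ}(Ψ(…,ψ̂ᵢ,…)) + Σ_{i<j} (−1)^{i+j} Ψ([ψᵢ,ψⱼ],…,ψ̂ᵢ,…,ψ̂ⱼ,…)`. -/
noncomputable def extCovDer (br : E → E → E) :
    (p : ℕ) → ((Fin p → E) → E) → (Fin (p + 1) → E) → E
  | 0, Ψ, ψ => ∑ i : Fin 1, ((-1 : ℤ) ^ (i : ℕ)) • br (ψ i) (Ψ (i.removeNth ψ))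
  | (q + 1), Ψ, ψ =>
      (∑ i : Fin (q + 2), ((-1 : ℤ) ^ (i : ℕ)) • br (ψ i) (Ψ (i.removeNth ψ)))
      + ∑ i : Fin (q + 2), ∑ j : Fin (q + 2),
          if h : i < j then
            ((-1 : ℤ) ^ ((i : ℕ) + (j : ℕ))) •
              Ψ (Fin.cons (br (ψ i) (ψ j))
                (fun l : Fin q =>
                  ψ (j.succAbove
                    ((⟨(i : ℕ), lt_of_lt_of_le (Fin.lt_def.mp h)
                        (Nat.lt_succ_iff.mp j.isLt)⟩ : Fin (q + 1)).succAbove l))))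
          else 0

end


section Helpers
variable {E : Type*} [AddCommGroup E]

/-- Insertion of `x` in the first slot. -/
def insF {p : ℕ} (x : E) (Ψ : (Fin (p + 1) → E) → E) : (Fin p → E) → E :=
  fun v => Ψ (Fin.cons x v)

/-- Lie derivative. -/
def lieD (br : E → E → E) {p : ℕ} (x : E) (Ψ : (Fin p → E) → E) : (Fin p → E) → E :=
  fun v => br x (Ψ v) - ∑ i, Ψ (Function.update v i (br x (v i)))

/-- Antisymmetry, recursively. -/
def SkewF : (p : ℕ) → ((Fin p → E) → E) → Prop
  | 0, _ => True
  | 1, _ => True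
  | p + 2, Ψ => (∀ x y, insF y (insF x Ψ) = - insF x (insF y Ψ)) ∧ ∀ x, SkewF (p + 1) (insF x Ψ)

/-- Compatibility with `H` and additivity, recursively. -/
def GoodF (H : E → E → E → E) : (p : ℕ) → ((Fin p → E) → E) → Prop
  | 0, Ψ => ∀ x y v, H x y (Ψ v) = 0
  | p + 1, Ψ => (∀ x y, insF (x + y) Ψ = insF x Ψ + insF y Ψ) ∧
      (∀ x y z, insF (H x y z) Ψ = 0) ∧ ∀ x, GoodF H p (insF x Ψ)

theorem ext_insF {p : ℕ} {Ψ Φ : (Fin (p + 1) → E) → E} (h : ∀ x, insF x Ψ = insF x Φ) :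
    Ψ = Φ := by
  funext v
  have := congrFun (h (v 0)) (Fin.tail v)
  simpa [insF] using this

theorem insF_sub {p : ℕ} (x : E) (Ψ Φ : (Fin (p + 1) → E) → E) :
    insF x (Ψ - Φ) = insF x Ψ - insF x Φ := rfl

theorem insF_add {p : ℕ} (x : E) (Ψ Φ : (Fin (p + 1) → E) → E) :
    insF x (Ψ + Φ) = insF x Ψ + insF x Φ := rfl

theorem insF_neg {p : ℕ} (x : E) (Ψ : (Fin (p + 1) → E) → E) :
    insF x (-Ψ) = - insF x Ψ := rfl

theorem insF_lieD (br : E → E → E) {p : ℕ} (x y : E) (Ψ : (Fin (p + 1) → E) → E) :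
    insF y (lieD br x Ψ) = lieD br x (insF y Ψ) - insF (br x y) Ψ := by
  funext v
  simp only [insF, lieD, Pi.sub_apply, Fin.sum_univ_succ, Fin.cons_zero, Fin.cons_succ,
    Fin.update_cons_zero, ← Fin.cons_update]
  abel

theorem skewF_insF {p : ℕ} {Ψ : (Fin (p + 1) → E) → E} (h : SkewF (p + 1) Ψ) (x : E) :
    SkewF p (insF x Ψ) := by
  cases p with
  | zero => trivial
  | succ p => exact h.2 x

theorem skewF_sub {p : ℕ} {Ψ Φ : (Fin p → E) → E} (h : SkewF p Ψ) (h' : SkewF p Φ) :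
    SkewF p (Ψ - Φ) := by
  induction p with
  | zero => trivial
  | succ p ih =>
    cases p with
    | zero => trivial
    | succ p =>
      refine ⟨fun x y => ?_, fun x => ih (skewF_insF h x) (skewF_insF h' x)⟩
      simp only [insF_sub, h.1 x y, h'.1 x y]
      abel

theorem skewF_move {p : ℕ} {Ψ : (Fin (p + 1) → E) → E} (h : SkewF (p + 1) Ψ) (y : E)
    (j : Fin (p + 1)) (v : Fin (p + 1) → E) :
    Ψ (Fin.cons y (j.removeNth v)) = ((-1 : ℤ) ^ (j : ℕ)) • Ψ (Function.update v j y) := by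
  induction p with
  | zero =>
    obtain rfl : j = 0 := Fin.fin_one_eq_zero j
    simp only [Fin.val_zero, pow_zero, one_smul]
    congr 1
    funext l
    obtain rfl : l = 0 := Fin.fin_one_eq_zero l
    simp
  | succ p ih =>
    induction v using Fin.consCases with
    | _ v0 v =>
    induction j using Fin.cases with
    | zero => simp [Fin.update_cons_zero]
    | succ j =>
      have e : (j.succ).removeNth (Fin.cons v0 v : Fin (p + 2) → E)
          = (Fin.cons v0 (j.removeNth v) : Fin (p + 1) → E) := by
        funext l
        induction l using Fin.cases <;> simp [Fin.removeNth]
      rw [e]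
      have h1 := congrFun (h.1 y v0) (j.removeNth v)
      have h2 := ih (skewF_insF h v0) j v
      simp only [insF, Pi.neg_apply] at h1 h2
      rw [h1, h2, Fin.cons_update, Fin.val_succ, pow_succ]
      simp

variable {br : E → E → E}

theorem extCovDer_sub (p : ℕ) (Ψ Φ : (Fin p → E) → E)
    (hr : ∀ a b c, br a (b - c) = br a b - br a c) :
    extCovDer br p (Ψ - Φ) = extCovDer br p Ψ - extCovDer br p Φ := by
  funext v
  cases p with
  | zero => simp [extCovDer, hr]
  | succ q =>
    simp only [extCovDer, Pi.sub_apply, hr, smul_sub, Finset.sum_sub_distrib]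
    have : ∀ a b c d e f : E, e = c - d → a - b + e = a + c - (b + d) := by
      intro a b c d e f h; rw [h]; abel
    apply this _ _ _ _ _ 0
    simp only [← Finset.sum_sub_distrib]
    refine Finset.sum_congr rfl fun i _ => Finset.sum_congr rfl fun j _ => ?_
    split_ifs <;> simp

theorem lieD_sub {p : ℕ} (x : E) (Ψ Φ : (Fin p → E) → E)
    (hr : ∀ a b c, br a (b - c) = br a b - br a c) :
    lieD br x (Ψ - Φ) = lieD br x Ψ - lieD br x Φ := by
  funext v
  simp only [lieD, Pi.sub_apply, hr, Finset.sum_sub_distrib]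
  abel

theorem insF_extCovDer_zero (x : E) (Ψ : (Fin 0 → E) → E) :
    insF x (extCovDer br 0 Ψ) = lieD br x Ψ := by
  funext v
  simp only [insF, extCovDer, lieD, Finset.univ_unique, Finset.sum_singleton]
  simp

theorem removeNth_succ_cons {p : ℕ} (x : E) (v : Fin (p + 1) → E) (j : Fin (p + 1)) :
    (j.succ).removeNth (Fin.cons x v : Fin (p + 2) → E)
          = (Fin.cons x (j.removeNth v) : Fin (p + 1) → E) := by
  funext l
  induction l using Fin.cases <;> simp [Fin.removeNth]

theorem cons_skip {q : ℕ} (x : E) (v : Fin (q + 2) → E) (i j : Fin (q + 2)) (h : (i : ℕ) < q + 1)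
    (h' : (i.succ : ℕ) < q + 2) :
    (fun l : Fin (q + 1) => (Fin.cons x v : Fin (q + 3) → E)
      (j.succ.succAbove ((⟨(i.succ : ℕ), h'⟩ : Fin (q + 2)).succAbove l)))
    = Fin.cons x (fun l : Fin q => v (j.succAbove ((⟨(i : ℕ), h⟩ : Fin (q + 1)).succAbove l))) := by
  have e : (⟨(i.succ : ℕ), h'⟩ : Fin (q + 2)) = Fin.succ ⟨(i : ℕ), h⟩ := by
    ext; simp
  rw [e]
  funext l
  induction l using Fin.cases with
  | zero => simp
  | succ l => rw [Fin.succ_succAbove_succ, Fin.succ_succAbove_succ, Fin.cons_succ, Fin.cons_succ]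

theorem insF_extCovDer_succ {p : ℕ} (x : E) (Ψ : (Fin (p + 1) → E) → E) (h : SkewF (p + 1) Ψ) 
    (hn : ∀ a b, br a (-b) = - br a b) :
    insF x (extCovDer br (p + 1) Ψ) = lieD br x Ψ - extCovDer br p (insF x Ψ) := by
  funext v
  have key : ∀ j : Fin (p + 1), ((-1 : ℤ) ^ ((j : ℕ) + 1)) •
      Ψ (Fin.cons (br x (v j)) (j.removeNth v)) = - Ψ (Function.update v j (br x (v j))) := by
    intro j
    rw [skewF_move h, smul_smul, ← pow_add]
    have : ((-1 : ℤ)) ^ ((j : ℕ) + 1 + j) = -1 := by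
      apply Odd.neg_one_pow; exact ⟨j, by ring⟩
    rw [this]; simp
  cases p with
  | zero =>
    have key0 := key 0
    simp only [insF, extCovDer, lieD, Pi.sub_apply, Fin.sum_univ_succ, Fin.sum_univ_zero] at key0 ⊢
    simp [Fin.removeNth] at key0 ⊢
    have e1 : Fin.removeNth 1 (Fin.cons x v : Fin 2 → E) = Fin.cons x (Fin.tail v) := by
      have := removeNth_succ_cons x v 0
      simpa using this
    have e2 : (fun l : Fin 0 => v l.succ) = Fin.tail v := rfl
    rw [e1, e2, key0]
    abel
  | succ q =>
    have A : extCovDer br (q + 1 + 1) Ψ (Fin.cons x v) =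
      (br x (Ψ v) + ∑ i : Fin (q + 2), ((-1 : ℤ) ^ ((i : ℕ) + 1)) •
          br (v i) (Ψ (Fin.cons x (i.removeNth v))))
      + ((∑ j : Fin (q + 2), ((-1 : ℤ) ^ ((j : ℕ) + 1)) •
          Ψ (Fin.cons (br x (v j)) (j.removeNth v)))
        + ∑ i : Fin (q + 2), ∑ j : Fin (q + 2),
          if h : i < j then
            ((-1 : ℤ) ^ ((i : ℕ) + (j : ℕ))) •
              Ψ (Fin.cons (br (v i) (v j)) (Fin.cons x
                (fun l : Fin q =>
                  v (j.succAbove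
                    ((⟨(i : ℕ), lt_of_lt_of_le (Fin.lt_def.mp h)
                        (Nat.lt_succ_iff.mp j.isLt)⟩ : Fin (q + 1)).succAbove l)))))
          else 0) := by
      rw [extCovDer]
      congr 1
      · rw [Fin.sum_univ_succ]
        simp only [removeNth_succ_cons, Fin.cons_succ, Fin.val_succ]
        simp
      · rw [Fin.sum_univ_succ]
        congr 1
        · rw [Fin.sum_univ_succ, dif_neg (by simp), zero_add]
          refine Finset.sum_congr rfl fun j _ => ?_
          rw [dif_pos (Fin.succ_pos j)]
          simp only [Fin.cons_zero, Fin.cons_succ, Fin.val_zero, Fin.val_succ, zero_add]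
          congr 3
          funext l
          have e : (⟨0, Nat.succ_pos _⟩ : Fin (q + 2)).succAbove l = l.succ := Fin.zero_succAbove l
          erw [e]
          rw [Fin.succ_succAbove_succ, Fin.cons_succ]
          rfl
        · refine Finset.sum_congr rfl fun i _ => ?_
          rw [Fin.sum_univ_succ, dif_neg (by simp), zero_add]
          refine Finset.sum_congr rfl fun j _ => ?_
          by_cases hij : i < j
          · rw [dif_pos hij, dif_pos (Fin.succ_lt_succ_iff.mpr hij), cons_skip]
            · simp only [Fin.cons_succ, Fin.val_succ]
              congr 1
              rw [show (i : ℕ) + 1 + (j + 1) = i + j + 2 by ring, pow_add]; simp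
            · have := Fin.lt_def.mp hij
              omega
          · rw [dif_neg hij, dif_neg (by simpa using hij)]
    simp only [insF]
    rw [A]
    simp only [key]
    simp only [Pi.sub_apply, lieD, extCovDer, insF]
    have e1 : ∀ i : Fin (q + 2), ((-1 : ℤ) ^ ((i : ℕ) + 1)) •
          br (v i) (Ψ (Fin.cons x (i.removeNth v))) = - (((-1 : ℤ) ^ (i : ℕ)) •
          br (v i) (Ψ (Fin.cons x (i.removeNth v)))) := by
      intro i; rw [pow_succ]; simp
    have e2 : ∀ (a : E) (w : Fin q → E), Ψ (Fin.cons a (Fin.cons x w)) =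
        - Ψ (Fin.cons x (Fin.cons a w)) := fun a w => congrFun (h.1 a x) w
    have e3 : ∀ (P : Prop) [Decidable P] (f : P → E), (if h : P then - f h else 0) =
        - (if h : P then f h else 0) := by
      intro P _ f; split_ifs <;> simp
    simp only [e1, e2, smul_neg, e3, Finset.sum_neg_distrib]
    abel

theorem skewF_lieD {p : ℕ} {Ψ : (Fin p → E) → E} (h : SkewF p Ψ) (x : E)
    (hr : ∀ a b c, br a (b - c) = br a b - br a c) :
    SkewF p (lieD br x Ψ) := by
  induction p with
  | zero => trivial
  | succ p ih =>
    cases p with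
    | zero => trivial
    | succ p =>
      refine ⟨fun y z => ?_, fun y => ?_⟩
      · have e : lieD br x (insF z (insF y Ψ)) =
            - lieD br x (insF y (insF z Ψ)) := by
          have h0 : lieD br x (0 : (Fin p → E) → E) = 0 := by
            have := lieD_sub x (0 : (Fin p → E) → E) 0 hr
            simpa using this
          rw [h.1 y z, ← zero_sub, lieD_sub _ _ _ hr, h0, zero_sub]
        simp only [insF_lieD, insF_sub, e]
        rw [h.1 y (br x z), h.1 (br x y) z]
        abel
      · rw [insF_lieD]
        exact skewF_sub (ih (skewF_insF h y)) (skewF_insF h _)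

theorem insF_neg_left {H : E → E → E → E} {p : ℕ} {Ψ : (Fin (p + 1) → E) → E}
    (h : GoodF H (p + 1) Ψ) (x : E) : insF (-x) Ψ = - insF x Ψ := by
  have h0 : insF 0 Ψ = 0 := by simpa using h.1 0 0
  have h1 := h.1 (-x) x
  rw [neg_add_cancel, h0] at h1
  exact eq_neg_of_add_eq_zero_left h1.symm

theorem skewF_extCovDer {H : E → E → E → E} {p : ℕ} {Ψ : (Fin p → E) → E} (h : SkewF p Ψ)
    (hg : GoodF H p Ψ) (hn : ∀ a b, br a (-b) = - br a b)
    (hr : ∀ a b c, br a (b - c) = br a b - br a c) (hs : ∀ a b, br a b = - br b a) :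
    SkewF (p + 1) (extCovDer br p Ψ) := by
  induction p with
  | zero => trivial
  | succ p ih =>
    refine ⟨fun x y => ?_, fun x => ?_⟩
    · rw [insF_extCovDer_succ _ _ h hn, insF_extCovDer_succ _ _ h hn, insF_sub, insF_sub,
        insF_lieD, insF_lieD, hs x y, insF_neg_left hg]
      cases p with
      | zero =>
        rw [insF_extCovDer_zero, insF_extCovDer_zero]
        abel
      | succ p =>
        have e : extCovDer br p (insF y (insF x Ψ)) = - extCovDer br p (insF x (insF y Ψ)) := by
          have h0 : extCovDer br p (0 : (Fin p → E) → E) = 0 := by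
            have := extCovDer_sub p (0 : (Fin p → E) → E) 0 hr
            simpa using this
          rw [h.1 x y, ← zero_sub, extCovDer_sub _ _ _ hr, h0, zero_sub]
        rw [insF_extCovDer_succ _ _ (skewF_insF h x) hn,
          insF_extCovDer_succ _ _ (skewF_insF h y) hn, e]
        abel
    · rw [insF_extCovDer_succ _ _ h hn]
      exact skewF_sub (skewF_lieD h x hr) (ih (skewF_insF h x) (hg.2.2 x))

theorem lieD_lieD {H : E → E → E → E} {p : ℕ} {Ψ : (Fin p → E) → E}
    (hg : GoodF H p Ψ)
    (hr : ∀ a b c, br a (b - c) = br a b - br a c)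
    (jac : ∀ a b c, br a (br b c) = br (br a b) c + br b (br a c) + H a b c) (x y : E) :
    lieD br x (lieD br y Ψ) = lieD br y (lieD br x Ψ) + lieD br (br x y) Ψ := by
  induction p with
  | zero =>
    funext v
    have := hg x y v
    simp only [lieD, Pi.add_apply, Finset.univ_eq_empty, Finset.sum_empty, sub_zero]
    rw [jac, this]
    abel
  | succ p ih =>
    apply ext_insF
    intro z
    have e : insF (br x (br y z)) Ψ = insF (br (br x y) z) Ψ + insF (br y (br x z)) Ψ := by
      rw [jac, hg.1, hg.1, hg.2.1, add_zero]
    simp only [insF_lieD, insF_add, lieD_sub _ _ _ hr]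
    rw [ih (hg.2.2 z), e]
    abel

theorem lieD_extCovDer {H : E → E → E → E} {p : ℕ} {Ψ : (Fin p → E) → E} (h : SkewF p Ψ)
    (hg : GoodF H p Ψ) (hn : ∀ a b, br a (-b) = - br a b)
    (hr : ∀ a b c, br a (b - c) = br a b - br a c)
    (jac : ∀ a b c, br a (br b c) = br (br a b) c + br b (br a c) + H a b c) (x : E) :
    lieD br x (extCovDer br p Ψ) = extCovDer br p (lieD br x Ψ) := by
  induction p with
  | zero =>
    apply ext_insF
    intro y
    rw [insF_lieD, insF_extCovDer_zero, insF_extCovDer_zero, insF_extCovDer_zero,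
      lieD_lieD hg hr jac]
    abel
  | succ p ih =>
    apply ext_insF
    intro y
    rw [insF_lieD, insF_extCovDer_succ _ _ h hn, insF_extCovDer_succ _ _ h hn,
      insF_extCovDer_succ _ _ (skewF_lieD h x hr) hn, insF_lieD, lieD_sub _ _ _ hr,
      extCovDer_sub _ _ _ hr, lieD_lieD hg hr jac, ih (skewF_insF h y) (hg.2.2 y)]
    abel

theorem extCovDer_extCovDer {H : E → E → E → E} {p : ℕ} {Ψ : (Fin p → E) → E} (h : SkewF p Ψ)
    (hg : GoodF H p Ψ) (hn : ∀ a b, br a (-b) = - br a b)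
    (hr : ∀ a b c, br a (b - c) = br a b - br a c) (hs : ∀ a b, br a b = - br b a)
    (jac : ∀ a b c, br a (br b c) = br (br a b) c + br b (br a c) + H a b c) :
    extCovDer br (p + 1) (extCovDer br p Ψ) = 0 := by
  induction p with
  | zero =>
    apply ext_insF
    intro x
    rw [insF_extCovDer_succ _ _ (skewF_extCovDer h hg hn hr hs) hn, insF_extCovDer_zero,
      lieD_extCovDer h hg hn hr jac, sub_self]
    rfl
  | succ p ih =>
    apply ext_insF
    intro x
    rw [insF_extCovDer_succ _ _ (skewF_extCovDer h hg hn hr hs) hn, insF_extCovDer_succ _ _ h hn,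
      lieD_extCovDer h hg hn hr jac, extCovDer_sub _ _ _ hr, ih (skewF_insF h x) (hg.2.2 x)]
    simp
    rfl

theorem skewF_of_alt {p : ℕ} {Ψ : (Fin p → E) → E}
    (alt : ∀ (v : Fin p → E) (i j : Fin p), i ≠ j → v i = v j → Ψ v = 0)
    (add : ∀ (v : Fin p → E) (i : Fin p) (x y : E),
      Ψ (Function.update v i (x + y)) = Ψ (Function.update v i x) + Ψ (Function.update v i y)) :
    SkewF p Ψ := by
  induction p with
  | zero => trivial
  | succ p ih =>
    cases p with
    | zero => trivial
    | succ p =>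
      refine ⟨fun x y => ?_, fun x => ih ?_ ?_⟩
      · funext v
        have a0 : ∀ a b c : E, Ψ (Fin.cons (a + b) (Fin.cons c v)) =
            Ψ (Fin.cons a (Fin.cons c v)) + Ψ (Fin.cons b (Fin.cons c v)) := by
          intro a b c
          simpa [Fin.update_cons_zero] using add (Fin.cons 0 (Fin.cons c v)) 0 a b
        have a1 : ∀ a b c : E, Ψ (Fin.cons c (Fin.cons (a + b) v)) =
            Ψ (Fin.cons c (Fin.cons a v)) + Ψ (Fin.cons c (Fin.cons b v)) := by
          intro a b c
          have := add (Fin.cons c (Fin.cons 0 v)) (Fin.succ 0) a b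
          simpa only [← Fin.cons_update, Fin.update_cons_zero] using this
        have z : ∀ a : E, Ψ (Fin.cons a (Fin.cons a v)) = 0 := by
          intro a
          refine alt _ 0 (Fin.succ 0) (Fin.succ_ne_zero _).symm ?_
          rw [Fin.cons_succ, Fin.cons_zero, Fin.cons_zero]
        have := z (x + y)
        rw [a0, a1, a1, z, z, zero_add, add_zero] at this
        exact eq_neg_of_add_eq_zero_left this
      · intro v i j hij hv
        exact alt _ i.succ j.succ (by simpa using hij) (by simpa using hv)
      · intro v i a b
        simpa only [insF, Fin.cons_update] using add (Fin.cons x v) i.succ a b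

theorem goodF_of {H : E → E → E → E} {p : ℕ} {Ψ : (Fin p → E) → E}
    (add : ∀ (v : Fin p → E) (i : Fin p) (x y : E),
      Ψ (Function.update v i (x + y)) = Ψ (Function.update v i x) + Ψ (Function.update v i y))
    (hH : ∀ (v : Fin p → E) (i : Fin p) (x y z : E), Ψ (Function.update v i (H x y z)) = 0)
    (hv : ∀ x y v, H x y (Ψ v) = 0) :
    GoodF H p Ψ := by
  induction p with
  | zero => exact hv
  | succ p ih =>
    refine ⟨fun x y => ?_, fun x y z => ?_, fun x => ih ?_ ?_ ?_⟩
    · funext v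
      simpa [insF, Fin.update_cons_zero] using add (Fin.cons 0 v) 0 x y
    · funext v
      simpa [insF, Fin.update_cons_zero] using hH (Fin.cons 0 v) 0 x y z
    · intro v i a b
      simpa only [insF, Fin.cons_update] using add (Fin.cons x v) i.succ a b
    · intro v i a b c
      simpa only [insF, Fin.cons_update] using hH (Fin.cons x v) i.succ a b c
    · intro a b v
      exact hv a b _

end Helpers

/-- For an `H`-twisted Lie–Rinehart algebra and a `ker ρ`-valued alternating
`R`-multilinear `p`-form `Ψ` such that (a) `H(Ψ(…),·,·) = 0` and (b) `Ψ(H(…),…) = 0`, the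
exterior covariant derivative squares to zero: `D(DΨ) = 0`.  In particular, if `H = 0`
then `D² = 0` on all `ker ρ`-valued forms. -/
theorem extCovDer_squared_eq_zero_on_naive_cochains
    {k R E : Type*} [Field k] [CommRing R] [Algebra k R]
    [AddCommGroup E] [Module k E] [Module R E] [IsScalarTower k R E]
    (ρ : E →ₗ[R] Derivation k R R)
    (br : E → E → E)
    (br_add_left : ∀ φ₁ φ₂ ψ : E, br (φ₁ + φ₂) ψ = br φ₁ ψ + br φ₂ ψ)
    (br_smul_left : ∀ (a : k) (φ ψ : E), br (a • φ) ψ = a • br φ ψ)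
    (br_skew : ∀ φ ψ : E, br φ ψ = - br ψ φ)
    (H : E →ₗ[R] E →ₗ[R] E →ₗ[R] E)
    (H_alt₁₂ : ∀ φ ψ : E, H φ φ ψ = 0)
    (H_alt₂₃ : ∀ φ ψ : E, H φ ψ ψ = 0)
    (H_ker : ∀ φ ψ χ : E, ρ (H φ ψ χ) = 0)
    (leibniz : ∀ (φ : E) (f : R) (ψ : E), br φ (f • ψ) = ρ φ f • ψ + f • br φ ψ)
    (jacobi : ∀ φ ψ₁ ψ₂ : E,
      br φ (br ψ₁ ψ₂) = br (br φ ψ₁) ψ₂ + br ψ₁ (br φ ψ₂) + H φ ψ₁ ψ₂)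
    (anchor_br : ∀ φ ψ : E, ρ (br φ ψ) = ⁅ρ φ, ρ ψ⁆)
    (p : ℕ) (Ψ : (Fin p → E) → E)
    -- Ψ takes values in ker ρ
    (Ψ_ker : ∀ v : Fin p → E, ρ (Ψ v) = 0)
    -- Ψ is alternating
    (Ψ_alt : ∀ (v : Fin p → E) (i j : Fin p), i ≠ j → v i = v j → Ψ v = 0)
    -- Ψ is R-multilinear
    (Ψ_add : ∀ (v : Fin p → E) (i : Fin p) (x y : E),
      Ψ (Function.update v i (x + y)) = Ψ (Function.update v i x) + Ψ (Function.update v i y))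
    (Ψ_smul : ∀ (v : Fin p → E) (i : Fin p) (f : R) (x : E),
      Ψ (Function.update v i (f • x)) = f • Ψ (Function.update v i x))
    -- (a) H annihilates the values of Ψ
    (hHΨ : ∀ (v : Fin p → E) (x y : E), H (Ψ v) x y = 0)
    -- (b) Ψ is annihilated by insertion of H (vacuous for p = 0)
    (hΨH : ∀ (x y z : E) (v : Fin p → E) (i : Fin p),
      Ψ (Function.update v i (H x y z)) = 0) :
    ∀ ψ : Fin (p + 2) → E, extCovDer br (p + 1) (extCovDer br p Ψ) ψ = 0 := by
  have hadd : ∀ a b c : E, br a (b + c) = br a b + br a c := by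
    intro a b c
    rw [br_skew, br_add_left, br_skew b, br_skew c]
    abel
  have h0 : ∀ a : E, br a 0 = 0 := by
    intro a
    simpa using hadd a 0 0
  have hn : ∀ a b : E, br a (-b) = - br a b := by
    intro a b
    have := hadd a (-b) b
    rw [neg_add_cancel, h0] at this
    exact eq_neg_of_add_eq_zero_left this.symm
  have hr : ∀ a b c : E, br a (b - c) = br a b - br a c := by
    intro a b c
    rw [sub_eq_add_neg, hadd, hn, ← sub_eq_add_neg]
  have H12 : ∀ a b c : E, H a b c = - H b a c := by
    intro a b c
    have := H_alt₁₂ (a + b) c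
    simp only [map_add, LinearMap.add_apply, H_alt₁₂, zero_add, add_zero] at this
    exact eq_neg_of_add_eq_zero_left (by rw [← this]; abel)
  have H23 : ∀ a b c : E, H a b c = - H a c b := by
    intro a b c
    have := H_alt₂₃ a (b + c)
    simp only [map_add, LinearMap.add_apply, H_alt₂₃, zero_add, add_zero] at this
    exact eq_neg_of_add_eq_zero_left (by rw [← this]; abel)
  intro ψ
  have hg : GoodF (fun a b c => H a b c) p Ψ :=
    goodF_of Ψ_add (fun v i x y z => hΨH x y z v i) (fun x y v => by
      show H x y (Ψ v) = 0
      rw [H23, H12, hHΨ]; simp)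
  exact congrFun (extCovDer_extCovDer (skewF_of_alt Ψ_alt Ψ_add) hg hn hr br_skew jacobi) ψ
end

section
/- Let (E, ρ, [.,.]) be an anchored almost Lie algebroid over a commutative k-algebra R, and let α and β be alternating R-multilinear forms on E with values in R of degrees p and q respectively. Then the Chevalley–Eilenberg-type differential D satisfies the graded Leibniz rule D(α ∧ β) = (Dα) ∧ β + (−1)^p α ∧ (Dβ), where ∧ denotes the wedge product of alternating forms. -/
section
variable {k R E : Type*} [Field k] [CommRing R] [Algebra k R]
  [AddCommGroup E] [Module k E] [Module R E] [IsScalarTower k R E]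

/-- The Chevalley–Eilenberg-type differential on scalar-valued alternating `p`-forms on
`E`, defined by the anchor `ρ` and the bracket. -/
noncomputable def ceDiff (ρ : E →ₗ[R] Derivation k R R) (br : E → E → E) :
    (p : ℕ) → ((Fin p → E) → R) → (Fin (p + 1) → E) → R
  | 0, ω, ψ => ∑ i : Fin 1, ((-1 : ℤ) ^ (i : ℕ)) • (ρ (ψ i)) (ω (i.removeNth ψ))
  | (q + 1), ω, ψ =>
      (∑ i : Fin (q + 2), ((-1 : ℤ) ^ (i : ℕ)) • (ρ (ψ i)) (ω (i.removeNth ψ)))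
      + ∑ i : Fin (q + 2), ∑ j : Fin (q + 2),
          if h : i < j then
            ((-1 : ℤ) ^ ((i : ℕ) + (j : ℕ))) •
              ω (Fin.cons (br (ψ i) (ψ j))
                (fun l : Fin q =>
                  ψ (j.succAbove
                    ((⟨(i : ℕ), lt_of_lt_of_le (Fin.lt_def.mp h)
                        (Nat.lt_succ_iff.mp j.isLt)⟩ : Fin (q + 1)).succAbove l))))
          else 0

/-- The wedge product of a scalar `p`-form and a scalar `q`-form, as a sum over
`(p,q)`-shuffles: a shuffle is encoded by the `p`-element subset `s` of indices fed to
`α` (in increasing order), the complement being fed to `β` (in increasing order);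
the sign of this shuffle is `(−1)^{Σ_{i∈s} i − p(p−1)/2}`. -/
noncomputable def wedgeForm (p q : ℕ) (α : (Fin p → E) → R) (β : (Fin q → E) → R) :
    (Fin (p + q) → E) → R :=
  fun ψ => ∑ s : Finset (Fin (p + q)),
    if h : s.card = p then
      (((-1 : ℤ) ^ (∑ i ∈ s, (i : ℕ)) * (-1 : ℤ) ^ (p * (p - 1) / 2)) •
        (α (fun a => ψ (s.orderIsoOfFin h a)) *
         β (fun a => ψ ((sᶜ).orderIsoOfFin
            (by rw [Finset.card_compl, h, Fintype.card_fin]; omega) a))))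
    else 0

end


section CEList
set_option linter.unusedSectionVars false
variable {k R E : Type*} [Field k] [CommRing R] [Algebra k R]
  [AddCommGroup E] [Module R E]

def ceHat (a : List E → R) : List E → R := fun l => (-1) ^ l.length * a l

def ceI (x : E) (a : List E → R) : List E → R := fun l => a (x :: l)

def ceW : (List E → R) → (List E → R) → List E → R
  | a, b, [] => a [] * b []
  | a, b, x :: l => ceW (ceI x a) b l + ceW (ceHat a) (ceI x b) l

def ceA (ρ : E →ₗ[R] Derivation k R R) : (List E → R) → List E → R
  | _, [] => 0
  | a, x :: l => ρ x (a l) - ceA ρ (ceI x a) l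

def ceC (br : E → E → E) (x : E) : (E → List E → R) → List E → R
  | _, [] => 0
  | t, y :: l => t (br x y) l - ceC br x (fun e => ceI y (t e)) l

def ceB (br : E → E → E) : (E → List E → R) → List E → R
  | _, [] => 0
  | t, x :: l => ceC br x t l + ceB br (fun e => ceI x (t e)) l

theorem ceHat_hat (a : List E → R) : ceHat (ceHat a) = a := by
  funext l; simp [ceHat, ← mul_assoc, ← pow_add, ← two_mul]

theorem ceI_hat (x : E) (a : List E → R) : ceI x (ceHat a) = - ceHat (ceI x a) := by
  funext l; simp [ceHat, ceI, pow_succ]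

theorem ceW_add_left (a a' b : List E → R) (l : List E) :
    ceW (a + a') b l = ceW a b l + ceW a' b l := by
  induction l generalizing a a' b with
  | nil => simp [ceW, add_mul]
  | cons x l ih =>
    have h1 : ceI x (a + a') = ceI x a + ceI x a' := rfl
    have h2 : ceHat (a + a') = ceHat a + ceHat a' := by funext l; simp [ceHat, mul_add]
    simp only [ceW, h1, h2, ih]; ring

theorem ceW_smul_left (c : R) (a b : List E → R) (l : List E) :
    ceW (c • a) b l = c * ceW a b l := by
  induction l generalizing a b with
  | nil => simp [ceW, mul_assoc]
  | cons x l ih =>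
    have h1 : ceI x (c • a) = c • ceI x a := rfl
    have h2 : ceHat (c • a) = c • ceHat a := by
      funext l; simp only [ceHat, Pi.smul_apply, smul_eq_mul]; ring
    simp only [ceW, h1, h2, ih]; ring

theorem ceW_add_right (a b b' : List E → R) (l : List E) :
    ceW a (b + b') l = ceW a b l + ceW a b' l := by
  induction l generalizing a b b' with
  | nil => simp [ceW, mul_add]
  | cons x l ih =>
    have h1 : ceI x (b + b') = ceI x b + ceI x b' := rfl
    simp only [ceW, h1, ih]; ring

theorem ceW_smul_right (c : R) (a b : List E → R) (l : List E) :
    ceW a (c • b) l = c * ceW a b l := by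
  induction l generalizing a b with
  | nil => simp [ceW]; ring
  | cons x l ih =>
    have h1 : ceI x (c • b) = c • ceI x b := rfl
    simp only [ceW, h1, ih]; ring

theorem ceW_neg_left (a b : List E → R) (l : List E) : ceW (-a) b l = - ceW a b l := by
  have := ceW_smul_left (-1) a b l
  simpa using this

theorem ceW_neg_right (a b : List E → R) (l : List E) : ceW a (-b) l = - ceW a b l := by
  have := ceW_smul_right (-1) a b l
  simpa using this

theorem ceA_add (ρ : E →ₗ[R] Derivation k R R) (a a' : List E → R) (l : List E) :
    ceA ρ (a + a') l = ceA ρ a l + ceA ρ a' l := by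
  induction l generalizing a a' with
  | nil => simp [ceA]
  | cons x l ih =>
    have h1 : ceI x (a + a') = ceI x a + ceI x a' := rfl
    simp only [ceA, h1, ih, Pi.add_apply, map_add]; ring

theorem ceA_neg (ρ : E →ₗ[R] Derivation k R R) (a : List E → R) (l : List E) :
    ceA ρ (-a) l = - ceA ρ a l := by
  induction l generalizing a with
  | nil => simp [ceA]
  | cons x l ih =>
    have h1 : ceI x (-a) = - ceI x a := rfl
    simp only [ceA, h1, ih, Pi.neg_apply, map_neg]; ring

theorem ceC_add (br : E → E → E) (x : E) (t t' : E → List E → R) (l : List E) :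
    ceC br x (fun e => t e + t' e) l = ceC br x t l + ceC br x t' l := by
  induction l generalizing t t' with
  | nil => simp [ceC]
  | cons y l ih =>
    have h1 : (fun e => ceI y (t e + t' e)) = fun e => ceI y (t e) + ceI y (t' e) := rfl
    simp only [ceC, h1, ih, Pi.add_apply]; ring

theorem ceC_neg (br : E → E → E) (x : E) (t : E → List E → R) (l : List E) :
    ceC br x (fun e => - t e) l = - ceC br x t l := by
  induction l generalizing t with
  | nil => simp [ceC]
  | cons y l ih =>
    have h1 : (fun e => ceI y (- t e)) = fun e => - ceI y (t e) := rfl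
    simp only [ceC, h1, ih, Pi.neg_apply]; ring

theorem ceB_add (br : E → E → E) (t t' : E → List E → R) (l : List E) :
    ceB br (fun e => t e + t' e) l = ceB br t l + ceB br t' l := by
  induction l generalizing t t' with
  | nil => simp [ceB]
  | cons y l ih =>
    have h1 : (fun e => ceI y (t e + t' e)) = fun e => ceI y (t e) + ceI y (t' e) := rfl
    simp only [ceB, h1, ih, ceC_add]; ring

theorem ceB_neg (br : E → E → E) (t : E → List E → R) (l : List E) :
    ceB br (fun e => - t e) l = - ceB br t l := by
  induction l generalizing t with
  | nil => simp [ceB]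
  | cons y l ih =>
    have h1 : (fun e => ceI y (- t e)) = fun e => - ceI y (t e) := rfl
    simp only [ceB, h1, ih, ceC_neg]; ring

theorem der_sign (D : Derivation k R R) (n : ℕ) (a : R) :
    D ((-1) ^ n * a) = (-1) ^ n * D a := by
  rcases neg_one_pow_eq_or R n with h | h <;> simp [h]

theorem ceA_hat (ρ : E →ₗ[R] Derivation k R R) (a : List E → R) :
    ceHat (ceA ρ a) = - ceA ρ (ceHat a) := by
  funext l
  induction l generalizing a with
  | nil => simp [ceA, ceHat]
  | cons x l ih =>
    have h := ih (ceI x a)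
    simp only [Pi.neg_apply] at h ⊢
    simp only [ceA, ceI_hat, ceA_neg, ← h]
    simp only [ceHat, ceA, der_sign, List.length_cons, pow_succ]
    ring

theorem ceC_hat (br : E → E → E) (x : E) (t : E → List E → R) :
    ceHat (ceC br x t) = - ceC br x (fun e => ceHat (t e)) := by
  funext l
  induction l generalizing t with
  | nil => simp [ceC, ceHat]
  | cons y l ih =>
    have h := ih (fun e => ceI y (t e))
    simp only [Pi.neg_apply] at h ⊢
    simp only [ceC, ceI_hat, ceC_neg]
    rw [← neg_eq_iff_eq_neg.mpr h]
    simp only [ceHat, ceC, List.length_cons, pow_succ]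
    ring

theorem ceB_hat (br : E → E → E) (t : E → List E → R) :
    ceHat (ceB br t) = ceB br (fun e => ceHat (t e)) := by
  funext l
  induction l generalizing t with
  | nil => simp [ceB, ceHat]
  | cons y l ih =>
    have h := ih (fun e => ceI y (t e))
    have h2 := congrFun (ceC_hat br y t) l
    simp only [Pi.neg_apply] at h2
    simp only [ceB, ceI_hat, ceB_neg]
    rw [← neg_eq_iff_eq_neg.mpr h2, ← h]
    simp only [ceHat, ceB, List.length_cons, pow_succ]
    ring

theorem ceW_der (D : Derivation k R R) (a b : List E → R) (l : List E) :
    D (ceW a b l) = ceW (fun l => D (a l)) b l + ceW a (fun l => D (b l)) l := by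
  induction l generalizing a b with
  | nil => simp [ceW]; ring
  | cons x l ih =>
    have h1 : (fun l => D (ceHat a l)) = ceHat (fun l => D (a l)) := by
      funext l; simp only [ceHat, der_sign]
    have h2 : ∀ c : List E → R, (fun l => D (ceI x c l)) = ceI x (fun l => D (c l)) :=
      fun _ => rfl
    simp only [ceW, map_add, ih, h1, h2]
    ring

theorem ceI_W (x : E) (a b : List E → R) :
    ceI x (ceW a b) = ceW (ceI x a) b + ceW (ceHat a) (ceI x b) := rfl

theorem ceA_W (ρ : E →ₗ[R] Derivation k R R) (a b : List E → R) (l : List E) :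
    ceA ρ (ceW a b) l = ceW (ceA ρ a) b l + ceW (ceHat a) (ceA ρ b) l := by
  induction l generalizing a b with
  | nil => simp [ceA, ceW]
  | cons x l ih =>
    have h : ∀ c : List E → R,
        ceI x (ceA ρ c) = (fun l => ρ x (c l)) + - ceA ρ (ceI x c) := by
      intro c; funext l; simp only [ceI, ceA, Pi.add_apply, Pi.neg_apply, sub_eq_add_neg]
    simp only [ceA, ceW, ceI_W, ceA_add, ih, ceW_der, h, ceI_hat, ceA_hat, ceHat_hat,
      ceW_add_left, ceW_add_right, ceW_neg_left, ceW_neg_right]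
    ring

theorem ceI_C (br : E → E → E) (x y : E) (t : E → List E → R) :
    ceI y (ceC br x t) = t (br x y) + - ceC br x (fun e => ceI y (t e)) := by
  funext l; simp only [ceI, ceC, Pi.add_apply, Pi.neg_apply, sub_eq_add_neg]

theorem ceC_W_left (br : E → E → E) (x : E) (t : E → List E → R) (b : List E → R)
    (l : List E) : ceC br x (fun e => ceW (t e) b) l = ceW (ceC br x t) b l := by
  induction l generalizing t b with
  | nil => simp [ceC, ceW]
  | cons y l ih =>
    simp only [ceC, ceW, ceI_W, ceC_add, ih, ceI_C, ceC_hat, ceW_add_left, ceW_neg_left]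
    ring

theorem ceC_W_right (br : E → E → E) (x : E) (a : List E → R) (t : E → List E → R)
    (l : List E) : ceC br x (fun e => ceW a (t e)) l = ceW (ceHat a) (ceC br x t) l := by
  induction l generalizing t a with
  | nil => simp [ceC, ceW]
  | cons y l ih =>
    simp only [ceC, ceW, ceI_W, ceC_add, ih, ceI_C, ceI_hat, ceHat_hat, ceW_add_right,
      ceW_neg_left, ceW_neg_right]
    ring

theorem ceI_B (br : E → E → E) (y : E) (t : E → List E → R) :
    ceI y (ceB br t) = ceC br y t + ceB br (fun e => ceI y (t e)) := rfl

theorem ceB_W_left (br : E → E → E) (t : E → List E → R) (b : List E → R)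
    (l : List E) : ceB br (fun e => ceW (t e) b) l = ceW (ceB br t) b l := by
  induction l generalizing t b with
  | nil => simp [ceB, ceW]
  | cons y l ih =>
    simp only [ceB, ceW, ceI_W, ceB_add, ih, ceI_B, ceB_hat, ceC_W_left, ceW_add_left]
    ring

theorem ceB_W_right (br : E → E → E) (a : List E → R) (t : E → List E → R)
    (l : List E) : ceB br (fun e => ceW a (t e)) l = ceW a (ceB br t) l := by
  induction l generalizing t a with
  | nil => simp [ceB, ceW]
  | cons y l ih =>
    simp only [ceB, ceW, ceI_W, ceB_add, ih, ceI_B, ceC_W_right, ceW_add_right]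
    ring

def ceD (ρ : E →ₗ[R] Derivation k R R) (br : E → E → E) (a : List E → R) : List E → R :=
  ceA ρ a + - ceB br (fun e => ceI e a)

theorem ceD_W (ρ : E →ₗ[R] Derivation k R R) (br : E → E → E) (a b : List E → R)
    (l : List E) :
    ceD ρ br (ceW a b) l = ceW (ceD ρ br a) b l + ceW (ceHat a) (ceD ρ br b) l := by
  simp only [ceD, Pi.add_apply, Pi.neg_apply, ceW_neg_left, ceW_neg_right, ceA_W, ceI_W, ceB_add, ceB_W_left, ceB_W_right, ceW_add_left,
    ceW_add_right]
  ring

def ceSupp (p : ℕ) (a : List E → R) : Prop := ∀ l, l.length ≠ p → a l = 0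


theorem ceA_zero (ρ : E →ₗ[R] Derivation k R R) (a : List E → R) (l : List E)
    (h : ∀ m, m.length + 1 = l.length → a m = 0) : ceA ρ a l = 0 := by
  induction l generalizing a with
  | nil => rfl
  | cons x l ih =>
    rw [ceA, h l (by simp), ih (ceI x a) (fun m hm => h (x :: m) (by simp [hm]))]
    simp

theorem ceC_zero (br : E → E → E) (x : E) (t : E → List E → R) (l : List E)
    (h : ∀ e m, m.length + 1 = l.length → t e m = 0) : ceC br x t l = 0 := by
  induction l generalizing t with
  | nil => rfl
  | cons y l ih =>
    rw [ceC, h _ l (by simp), ih (fun e => ceI y (t e)) (fun e m hm => h e (y :: m) (by simp [hm]))]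
    simp

theorem ceB_zero (br : E → E → E) (t : E → List E → R) (l : List E)
    (h : ∀ e m, m.length + 2 = l.length → t e m = 0) : ceB br t l = 0 := by
  induction l generalizing t with
  | nil => rfl
  | cons y l ih =>
    rw [ceB, ceC_zero br y t l (fun e m hm => h _ _ (by simp [← hm])),
      ih (fun e => ceI y (t e)) (fun e m hm => h e (y :: m) (by simp [← hm]))]
    simp

theorem ceD_supp (ρ : E →ₗ[R] Derivation k R R) (br : E → E → E) (p : ℕ) (a : List E → R)
    (h : ceSupp p a) : ceSupp (p + 1) (ceD ρ br a) := by
  intro l hl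
  rw [ceD, Pi.add_apply, Pi.neg_apply, ceA_zero, ceB_zero, neg_zero, add_zero]
  · intro e m hm; exact h _ (by simp; omega)
  · intro m hm; exact h _ (by omega)

theorem ceHat_supp (p : ℕ) (a : List E → R) (h : ceSupp p a) :
    ceHat a = ((-1 : R) ^ p) • a := by
  funext l
  by_cases hl : l.length = p
  · simp [ceHat, hl]
  · simp [ceHat, h l hl]

theorem ceA_ofFn (ρ : E →ₗ[R] Derivation k R R) (n : ℕ) (a : List E → R)
    (ψ : Fin (n + 1) → E) :
    ∑ i : Fin (n + 1), ((-1 : ℤ) ^ (i : ℕ)) • (ρ (ψ i)) (a (List.ofFn (i.removeNth ψ))) =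
      ceA ρ a (List.ofFn ψ) := by
  induction n generalizing a with
  | zero => simp [ceA]
  | succ n ih =>
    rw [Fin.sum_univ_succ, List.ofFn_succ (f := ψ), ceA, ← ih]
    have : ∀ i : Fin (n + 1), List.ofFn (i.succ.removeNth ψ) =
        ψ 0 :: List.ofFn (i.removeNth fun j => ψ j.succ) := by
      intro i
      rw [List.ofFn_succ]
      simp [Fin.removeNth_apply]
      rfl
    simp only [this, Fin.val_succ, pow_succ]
    simp [ceI, Finset.sum_neg_distrib, sub_eq_add_neg, Fin.removeNth_zero]
    rfl

theorem ceC_ofFn (br : E → E → E) (x : E) (n : ℕ) (t : E → List E → R)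
    (ψ : Fin (n + 1) → E) :
    ∑ j : Fin (n + 1), ((-1 : ℤ) ^ (j : ℕ)) • t (br x (ψ j)) (List.ofFn (j.removeNth ψ)) =
      ceC br x t (List.ofFn ψ) := by
  induction n generalizing t with
  | zero => simp [ceC]
  | succ n ih =>
    rw [Fin.sum_univ_succ, List.ofFn_succ (f := ψ), ceC, ← ih]
    have : ∀ i : Fin (n + 1), List.ofFn (i.succ.removeNth ψ) =
        ψ 0 :: List.ofFn (i.removeNth fun j => ψ j.succ) := by
      intro i
      rw [List.ofFn_succ]
      simp [Fin.removeNth_apply]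
      rfl
    simp only [this, Fin.val_succ, pow_succ]
    simp [ceI, Finset.sum_neg_distrib, sub_eq_add_neg, Fin.removeNth_zero]
    rfl

theorem ceB_ofFn (br : E → E → E) (n : ℕ) (t : E → List E → R)
    (ψ : Fin (n + 2) → E) :
    (∑ i : Fin (n + 2), ∑ j : Fin (n + 2),
          if h : i < j then
            ((-1 : ℤ) ^ ((i : ℕ) + (j : ℕ))) •
              t (br (ψ i) (ψ j))
                (List.ofFn (fun l : Fin n =>
                  ψ (j.succAbove
                    ((⟨(i : ℕ), lt_of_lt_of_le (Fin.lt_def.mp h)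
                        (Nat.lt_succ_iff.mp j.isLt)⟩ : Fin (n + 1)).succAbove l))))
          else 0) =
      - ceB br t (List.ofFn ψ) := by
  induction n generalizing t with
  | zero =>
    simp [Fin.sum_univ_succ, ceB, ceC]
  | succ n ih =>
    rw [Fin.sum_univ_succ, List.ofFn_succ (f := ψ), ceB, ← ceC_ofFn, neg_add, ← ih]
    congr 1
    · rw [Fin.sum_univ_succ, ← Finset.sum_neg_distrib]
      simp only [lt_self_iff_false, dite_false, zero_add]
      refine Finset.sum_congr rfl fun j _ => ?_
      rw [dif_pos (Fin.succ_pos j)]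
      simp [pow_succ, Fin.removeNth_apply]
    · refine Finset.sum_congr rfl fun i _ => ?_
      rw [Fin.sum_univ_succ, dif_neg (by simp), zero_add]
      refine Finset.sum_congr rfl fun j _ => ?_
      by_cases h : i < j
      · rw [dif_pos h, dif_pos (Fin.succ_lt_succ_iff.mpr h), List.ofFn_succ]
        have e : (-1 : ℤ) ^ ((i.succ : ℕ) + (j.succ : ℕ)) = (-1) ^ ((i : ℕ) + (j : ℕ)) := by
          simp only [Fin.val_succ]; ring
        rw [e, ceI]
        have e0 : (⟨(i.succ : ℕ), lt_of_lt_of_le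
            (Fin.lt_def.mp (Fin.succ_lt_succ_iff.mpr h))
            (Nat.lt_succ_iff.mp j.succ.isLt)⟩ : Fin (n + 2)) =
            Fin.succ (⟨(i : ℕ), lt_of_lt_of_le (Fin.lt_def.mp h)
                        (Nat.lt_succ_iff.mp j.isLt)⟩ : Fin (n + 1)) := rfl
        simp only [e0, Fin.succ_succAbove_succ, Fin.succ_succAbove_zero]
      · rw [dif_neg h, dif_neg (by simpa using h)]

theorem ceDiff_ofFn (ρ : E →ₗ[R] Derivation k R R) (br : E → E → E) (n : ℕ) (a : List E → R)
    (ψ : Fin (n + 1) → E) :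
    ceDiff ρ br n (fun v => a (List.ofFn v)) ψ = ceD ρ br a (List.ofFn ψ) := by
  cases n with
  | zero =>
    rw [ceDiff, ceA_ofFn]
    simp [ceD, ceB, ceC]
  | succ n =>
    rw [ceDiff, ceA_ofFn, ceD, Pi.add_apply, Pi.neg_apply,
      ← ceB_ofFn br n (fun e => ceI e a) ψ]
    simp only [List.ofFn_succ, Fin.cons_zero, Fin.cons_succ, ceI]

end CEList

section CEBridge
set_option linter.unusedSectionVars false
variable {k R E : Type*} [Field k] [CommRing R] [Algebra k R]
  [AddCommGroup E] [Module R E]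

def ceSel {n : ℕ} (s : Finset (Fin n)) (ψ : Fin n → E) : List E :=
  ((List.finRange n).filter (· ∈ s)).map ψ

theorem ceSel_sort {n : ℕ} (s : Finset (Fin n)) :
    s.sort (· ≤ ·) = (List.finRange n).filter (· ∈ s) := by
  apply List.Perm.eq_of_pairwise (le := (· ≤ ·))
  · intro a b _ _ h1 h2; exact le_antisymm h1 h2
  · exact Finset.pairwise_sort s (· ≤ ·)
  · exact List.Pairwise.filter _ (List.pairwise_le_finRange n)
  · rw [List.perm_ext_iff_of_nodup (Finset.sort_nodup _ _) ((List.nodup_finRange n).filter _)]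
    simp

theorem ceSel_eq {n m : ℕ} (s : Finset (Fin n)) (h : s.card = m) (ψ : Fin n → E) :
    List.ofFn (fun a => ψ (s.orderIsoOfFin h a)) = ceSel s ψ := by
  rw [ceSel, ← ceSel_sort, ← Finset.listMap_orderEmbOfFin_finRange s h, List.map_map,
    List.ofFn_eq_map]
  rfl

theorem ceSel_length {n : ℕ} (s : Finset (Fin n)) (ψ : Fin n → E) :
    (ceSel s ψ).length = s.card := by
  rw [← ceSel_eq s rfl, List.length_ofFn]

theorem ceSel_zero_mem {n : ℕ} (s : Finset (Fin (n + 1))) (t : Finset (Fin n))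
    (h0 : 0 ∈ s) (h : ∀ i, i.succ ∈ s ↔ i ∈ t) (ψ : Fin (n + 1) → E) :
    ceSel s ψ = ψ 0 :: ceSel t (fun i => ψ i.succ) := by
  simp [ceSel, List.finRange_succ, h0, List.filter_map, Function.comp_def, h]

theorem ceSel_zero_notMem {n : ℕ} (s : Finset (Fin (n + 1))) (t : Finset (Fin n))
    (h0 : 0 ∉ s) (h : ∀ i, i.succ ∈ s ↔ i ∈ t) (ψ : Fin (n + 1) → E) :
    ceSel s ψ = ceSel t (fun i => ψ i.succ) := by
  simp [ceSel, List.finRange_succ, h0, List.filter_map, Function.comp_def, h]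

theorem sum_finset_fin_succ {M : Type*} [AddCommMonoid M] {n : ℕ}
    (f : Finset (Fin (n + 1)) → M) :
    ∑ s, f s = ∑ t : Finset (Fin n), f (insert 0 (t.map (Fin.succEmb n)))
      + ∑ t : Finset (Fin n), f (t.map (Fin.succEmb n)) := by
  have h0 : (0 : Fin (n + 1)) ∉ (Finset.univ : Finset (Fin n)).map (Fin.succEmb n) := by
    simp
  have h1 : (Finset.univ : Finset (Fin (n + 1))) =
      insert 0 ((Finset.univ : Finset (Fin n)).map (Fin.succEmb n)) := by
    ext i; refine Fin.cases ?_ (fun i => ?_) i <;> simp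
  have h2 : ∀ g : Finset (Fin (n + 1)) → M,
      ∑ t ∈ ((Finset.univ : Finset (Fin n)).map (Fin.succEmb n)).powerset, g t =
      ∑ t : Finset (Fin n), g (t.map (Fin.succEmb n)) := by
    intro g
    symm
    refine Finset.sum_bij (fun t _ => t.map (Fin.succEmb n)) ?_ ?_ ?_ ?_
    · intro t _
      rw [Finset.mem_powerset]
      exact Finset.map_subset_map.mpr (Finset.subset_univ _)
    · intro a _ b _ h; exact Finset.map_injective _ h
    · intro b hb
      rw [Finset.mem_powerset, Finset.subset_map_iff] at hb
      obtain ⟨t, _, rfl⟩ := hb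
      exact ⟨t, Finset.mem_univ _, rfl⟩
    · intros; rfl
  rw [← Finset.powerset_univ, h1, Finset.sum_powerset_insert h0, h2, h2, add_comm]

theorem ceW_ofFn (n : ℕ) (a b : List E → R) (ψ : Fin n → E) :
    ∑ s : Finset (Fin n), ((-1 : R) ^ (∑ i ∈ s, (i : ℕ)) * (-1) ^ (s.card.choose 2)) *
      (a (ceSel s ψ) * b (ceSel sᶜ ψ)) = ceW a b (List.ofFn ψ) := by
  induction n generalizing a b with
  | zero =>
    have h : (default : Finset (Fin 0)) = ∅ := Subsingleton.elim _ _
    simp [ceW, ceSel, h]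
  | succ n ih =>
    rw [sum_finset_fin_succ, List.ofFn_succ, ceW, ← ih, ← ih]
    have hsum : ∀ t : Finset (Fin n), ∑ i ∈ t.map (Fin.succEmb n), (i : ℕ) =
        ∑ i ∈ t, (i : ℕ) + t.card := by
      intro t; simp [Finset.sum_add_distrib]
    have hsq : ∀ c : ℕ, (-1 : R) ^ c * (-1) ^ c = 1 := by
      intro c; rw [← mul_pow]; simp
    congr 1
    · refine Finset.sum_congr rfl fun t _ => ?_
      have h0 : (0 : Fin (n + 1)) ∉ t.map (Fin.succEmb n) := by simp
      rw [ceSel_zero_mem _ t (by simp) (by simp), ceSel_zero_notMem _ tᶜ (by simp) (by simp),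
        Finset.sum_insert h0, Finset.card_insert_of_notMem h0, hsum, Finset.card_map,
        Nat.choose_succ_succ' _ 1, Nat.choose_one_right, ceI]
      simp only [Fin.val_zero, zero_add, pow_add]
      linear_combination ((-1 : R) ^ (∑ i ∈ t, (i : ℕ)) * (-1) ^ (t.card.choose 2)) *
        (a (ψ 0 :: ceSel t fun i => ψ i.succ) * b (ceSel tᶜ fun i => ψ i.succ)) * hsq t.card
    · refine Finset.sum_congr rfl fun t _ => ?_
      rw [ceSel_zero_notMem _ t (by simp) (by simp), ceSel_zero_mem _ tᶜ (by simp) (by simp),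
        hsum, Finset.card_map, ceI, ceHat, ceSel_length]
      simp only [pow_add]
      ring

theorem wedgeForm_ofFn (p q : ℕ) (a b : List E → R) (ha : ceSupp p a)
    (ψ : Fin (p + q) → E) :
    wedgeForm p q (fun v => a (List.ofFn v)) (fun v => b (List.ofFn v)) ψ =
      ceW a b (List.ofFn ψ) := by
  rw [wedgeForm, ← ceW_ofFn]
  refine Finset.sum_congr rfl fun s _ => ?_
  split_ifs with h
  · rw [ceSel_eq, ceSel_eq, h, Nat.choose_two_right, zsmul_eq_mul]
    push_cast
    rfl
  · rw [ha (ceSel s ψ) (by rwa [ceSel_length])]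
    simp

def ceExt (p : ℕ) (α : (Fin p → E) → R) : List E → R :=
  fun l => if h : l.length = p then α (fun i => l.get (Fin.cast h.symm i)) else 0

theorem ceExt_supp (p : ℕ) (α : (Fin p → E) → R) : ceSupp p (ceExt p α) := by
  intro l hl; simp [ceExt, hl]

theorem ceExt_ofFn (p : ℕ) (α : (Fin p → E) → R) :
    (fun v => ceExt p α (List.ofFn v)) = α := by
  funext v
  simp [ceExt]

theorem ofFn_cast {m n : ℕ} (h : m = n) (ψ : Fin n → E) :
    List.ofFn (fun i : Fin m => ψ (Fin.cast h i)) = List.ofFn ψ := by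
  subst h; rfl

theorem ceDiff_wedge_aux (ρ : E →ₗ[R] Derivation k R R) (br : E → E → E)
    (p q : ℕ) (α : (Fin p → E) → R) (β : (Fin q → E) → R) (ψ : Fin (p + q + 1) → E)
    (h1 : p + 1 + q = p + q + 1) (h2 : p + (q + 1) = p + q + 1) :
      ceDiff ρ br (p + q) (wedgeForm p q α β) ψ =
        wedgeForm (p + 1) q (ceDiff ρ br p α) β (fun i => ψ (Fin.cast h1 i))
        + ((-1 : ℤ) ^ p) •
          wedgeForm p (q + 1) α (ceDiff ρ br q β) (fun i => ψ (Fin.cast h2 i)) := by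
  obtain ⟨a, ha, rfl⟩ : ∃ a : List E → R, ceSupp p a ∧ (fun v => a (List.ofFn v)) = α :=
    ⟨_, ceExt_supp p α, ceExt_ofFn p α⟩
  obtain ⟨b, hb, rfl⟩ : ∃ b : List E → R, ceSupp q b ∧ (fun v => b (List.ofFn v)) = β :=
    ⟨_, ceExt_supp q β, ceExt_ofFn q β⟩
  have e1 : wedgeForm p q (fun v => a (List.ofFn v)) (fun v => b (List.ofFn v)) =
      fun v => ceW a b (List.ofFn v) := by
    funext v; exact wedgeForm_ofFn p q a b ha v
  have e2 : ceDiff ρ br p (fun v => a (List.ofFn v)) =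
      fun v => ceD ρ br a (List.ofFn v) := by
    funext v; exact ceDiff_ofFn ρ br p a v
  have e3 : ceDiff ρ br q (fun v => b (List.ofFn v)) =
      fun v => ceD ρ br b (List.ofFn v) := by
    funext v; exact ceDiff_ofFn ρ br q b v
  rw [e1, e2, e3, ceDiff_ofFn, wedgeForm_ofFn _ _ _ _ (ceD_supp ρ br p a ha),
    wedgeForm_ofFn _ _ _ _ ha, ofFn_cast, ofFn_cast, ceD_W, ceHat_supp p a ha, ceW_smul_left,
    zsmul_eq_mul]
  push_cast
  rfl

end CEBridge


/-- for an anchored almost Lie algebroid `(E,ρ,[.,.])` over a commutative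
`k`-algebra `R` and alternating `R`-multilinear scalar forms `α` (degree `p`) and `β`
(degree `q`), the differential `D` satisfies the graded Leibniz rule
`D(α∧β) = (Dα)∧β + (−1)^p α∧(Dβ)`. -/
theorem ceDiff_wedge_leibniz
    {k R E : Type*} [Field k] [CommRing R] [Algebra k R]
    [AddCommGroup E] [Module k E] [Module R E] [IsScalarTower k R E]
    (ρ : E →ₗ[R] Derivation k R R)
    (br : E → E → E)
    (br_add_left : ∀ φ₁ φ₂ ψ : E, br (φ₁ + φ₂) ψ = br φ₁ ψ + br φ₂ ψ)
    (br_smul_left : ∀ (a : k) (φ ψ : E), br (a • φ) ψ = a • br φ ψ)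
    (br_skew : ∀ φ ψ : E, br φ ψ = - br ψ φ)
    (leibniz : ∀ (φ : E) (f : R) (ψ : E), br φ (f • ψ) = ρ φ f • ψ + f • br φ ψ)
    (anchor_br : ∀ φ ψ : E, ρ (br φ ψ) = ⁅ρ φ, ρ ψ⁆)
    (p q : ℕ) (α : (Fin p → E) → R) (β : (Fin q → E) → R)
    (α_alt : ∀ (v : Fin p → E) (i j : Fin p), i ≠ j → v i = v j → α v = 0)
    (α_add : ∀ (v : Fin p → E) (i : Fin p) (x y : E),
      α (Function.update v i (x + y)) = α (Function.update v i x) + α (Function.update v i y))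
    (α_smul : ∀ (v : Fin p → E) (i : Fin p) (f : R) (x : E),
      α (Function.update v i (f • x)) = f • α (Function.update v i x))
    (β_alt : ∀ (v : Fin q → E) (i j : Fin q), i ≠ j → v i = v j → β v = 0)
    (β_add : ∀ (v : Fin q → E) (i : Fin q) (x y : E),
      β (Function.update v i (x + y)) = β (Function.update v i x) + β (Function.update v i y))
    (β_smul : ∀ (v : Fin q → E) (i : Fin q) (f : R) (x : E),
      β (Function.update v i (f • x)) = f • β (Function.update v i x)) :
    ∀ ψ : Fin (p + q + 1) → E,
      ceDiff ρ br (p + q) (wedgeForm p q α β) ψ =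
        wedgeForm (p + 1) q (ceDiff ρ br p α) β
          (fun i => ψ (Fin.cast (by omega) i))
        + ((-1 : ℤ) ^ p) •
          wedgeForm p (q + 1) α (ceDiff ρ br q β)
            (fun i => ψ (Fin.cast (by omega) i)) := by
  intro ψ
  exact ceDiff_wedge_aux ρ br p q α β ψ _ _
end

section
/- Let (E, ρ, [.,.]) be an anchored almost Lie algebroid over a commutative k-algebra R, and let α₁, …, α_k : E → R be R-linear maps (scalar E-1-forms). Then the square of the Chevalley–Eilenberg-type differential D acts as a derivation without signs on wedge products: D(D(α₁ ∧ ⋯ ∧ α_k)) = Σ_{i=1}^{k} α₁ ∧ ⋯ ∧ α_{i−1} ∧ D(D(α_i)) ∧ α_{i+1} ∧ ⋯ ∧ α_k. -/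
section
variable {k R E : Type*} [Field k] [CommRing R] [Algebra k R]
  [AddCommGroup E] [Module k E] [Module R E] [IsScalarTower k R E]

/-- A (scalar) `E`-1-form regarded as a 1-form in the above sense. -/
noncomputable def oneForm (α : E →ₗ[R] R) : (Fin 1 → E) → R := fun v => α (v 0)

/-- The iterated wedge product `α₁ ∧ ⋯ ∧ α_n` of `E`-1-forms. -/
noncomputable def multiWedge : (n : ℕ) → (Fin n → (E →ₗ[R] R)) → (Fin n → E) → R
  | 0, _, _ => 1
  | (m + 1), αs, ψ =>
      wedgeForm 1 m (oneForm (αs 0)) (multiWedge m (fun i => αs i.succ))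
        (fun l => ψ (Fin.cast (by omega) l))

end

set_option linter.unusedSectionVars false

namespace CEAux

section
variable {E M N : Type*} [AddCommGroup M] [AddCommGroup N]

/-- Signed sum over all splittings of a list into a sublist and its complement. -/
def S : (List E → List E → M) → List E → M
  | B, [] => B [] []
  | B, (x :: l) => S (fun s t => B (x :: s) t) l
      + S (fun s t => ((-1 : ℤ) ^ s.length) • B s (x :: t)) l

theorem S_congr (l : List E) : ∀ (B C : List E → List E → M),
    (∀ s t, s.length + t.length = l.length → B s t = C s t) → S B l = S C l := by
  induction l with
  | nil => intro B C h; exact h [] [] rfl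
  | cons x l ih =>
    intro B C h
    simp only [S]
    congr 1
    · apply ih; intro s t hst; apply h; simp; omega
    · apply ih; intro s t hst; rw [h]; simp; omega

theorem S_zero (l : List E) : S (fun _ _ => (0 : M)) l = 0 := by
  induction l with
  | nil => rfl
  | cons x l ih => simp [S, ih]

theorem S_add (l : List E) : ∀ (B C : List E → List E → M),
    S (fun s t => B s t + C s t) l = S B l + S C l := by
  induction l with
  | nil => intro B C; rfl
  | cons x l ih =>
    intro B C
    simp only [S, smul_add, ih]
    abel

theorem S_map (f : M →+ N) (l : List E) : ∀ (B : List E → List E → M),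
    f (S B l) = S (fun s t => f (B s t)) l := by
  induction l with
  | nil => intro B; rfl
  | cons x l ih =>
    intro B
    simp only [S, map_add, ih, map_zsmul]

theorem S_zsmul (c : ℤ) (l : List E) (B : List E → List E → M) :
    S (fun s t => c • B s t) l = c • S B l :=
  (S_map (DistribSMul.toAddMonoidHom M c) l B).symm

theorem S_neg (l : List E) (B : List E → List E → M) :
    S (fun s t => - B s t) l = - S B l :=
  (S_map (negAddMonoidHom : M →+ M) l B).symm

theorem S_assoc (l : List E) : ∀ (T : List E → List E → List E → M),
    S (fun s t => S (fun u v => T s u v) t) l = S (fun p v => S (fun s u => T s u v) p) l := by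
  induction l with
  | nil => intro T; rfl
  | cons x l ih =>
    intro T
    simp only [S, smul_add, S_add]
    rw [ih, add_assoc]
    congr 1
    congr 1
    · simp only [← S_zsmul]
      rw [ih]
    · simp only [← S_zsmul]
      rw [ih]
      apply S_congr
      intro p v _
      apply S_congr
      intro s u h
      rw [← h, pow_add, mul_smul]

theorem S_comm (l : List E) : ∀ (T : List E → List E → M),
    S T l = S (fun u s => ((-1 : ℤ) ^ (s.length * u.length)) • T s u) l := by
  induction l with
  | nil => intro T; simp [S]
  | cons x l ih =>
    intro T
    simp only [S]
    rw [ih, ih (fun s t => ((-1 : ℤ) ^ s.length) • T s (x :: t)), add_comm]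
    congr 1
    · apply S_congr
      intro s t _
      rw [smul_smul, ← pow_add]
      simp [mul_add]
    · apply S_congr
      intro s t _
      rw [smul_smul, ← pow_add]
      congr 1
      have h2 : ((-1 : ℤ) ^ s.length) * (-1) ^ s.length = 1 := by rw [← mul_pow]; simp
      simp only [List.length_cons, pow_add, add_mul, one_mul]
      linear_combination (-(-1 : ℤ) ^ (t.length * s.length)) * h2

end

section
variable {k R E : Type*} [Field k] [CommRing R] [Algebra k R]
  [AddCommGroup E] [Module R E]

def W (α β : List E → R) (l : List E) : R := S (fun s t => α s * β t) l

def bar (α : List E → R) (l : List E) : R := ((-1 : ℤ) ^ l.length) • α l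

def DB (ρ : E →ₗ[R] Derivation k R R) (br : E → E → E) (ω : List E → R) :
    List E → List E → R
  | [x], t => ρ x (ω t)
  | [x, y], t => - ω (br x y :: t)
  | _, _ => 0

def DD (ρ : E →ₗ[R] Derivation k R R) (br : E → E → E) (ω : List E → R) (l : List E) : R :=
  S (DB ρ br ω) l

variable (ρ : E →ₗ[R] Derivation k R R) (br : E → E → E)

theorem W_assoc (α β γ : List E → R) : W (W α β) γ = W α (W β γ) := by
  funext l
  unfold W
  have h1 : ∀ p v, S (fun s t => α s * β t) p * γ v = S (fun s t => α s * β t * γ v) p :=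
    fun p v => S_map (AddMonoidHom.mulRight (γ v)) p _
  have h2 : ∀ p v, α p * S (fun s t => β s * γ t) v = S (fun s t => α p * (β s * γ t)) v :=
    fun p v => S_map (AddMonoidHom.mulLeft (α p)) v _
  simp only [h1, h2, ← mul_assoc]
  exact (S_assoc l (fun s t v => α s * β t * γ v)).symm

theorem W_add_left (α α' β : List E → R) : W (α + α') β = W α β + W α' β := by
  funext l
  simp only [W, Pi.add_apply, add_mul, S_add]

theorem W_add_right (α β β' : List E → R) : W α (β + β') = W α β + W α β' := by
  funext l
  simp only [W, Pi.add_apply, mul_add, S_add]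

theorem W_zero_right (α : List E → R) : W α 0 = 0 := by
  funext l
  simp only [W, Pi.zero_apply, mul_zero, S_zero]

theorem W_neg_left (α β : List E → R) : W (-α) β = - W α β := by
  funext l
  simp only [W, Pi.neg_apply, neg_mul, S_neg]

theorem bar_bar (α : List E → R) : bar (bar α) = α := by
  funext l
  simp only [bar, smul_smul, ← mul_pow]
  simp

theorem DB_add (α β : List E → R) (s t : List E) :
    DB ρ br (α + β) s t = DB ρ br α s t + DB ρ br β s t := by
  rcases s with _ | ⟨x, _ | ⟨y, _ | ⟨z, s⟩⟩⟩ <;> simp [DB]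
  abel

theorem DD_add (α β : List E → R) : DD ρ br (α + β) = DD ρ br α + DD ρ br β := by
  funext l
  simp only [DD, Pi.add_apply, ← S_add]
  apply S_congr; intro s t _; exact DB_add ρ br α β s t

theorem DD_bar (α : List E → R) : DD ρ br (bar α) = - bar (DD ρ br α) := by
  funext l
  simp only [DD, Pi.neg_apply, bar, ← S_zsmul, ← S_neg]
  apply S_congr
  intro s t h
  rw [← h]
  rcases s with _ | ⟨x, _ | ⟨y, _ | ⟨z, s⟩⟩⟩ <;> simp [DB, bar, pow_add]

theorem DD_W (α β : List E → R) :
    DD ρ br (W α β) = W (DD ρ br α) β + W (bar α) (DD ρ br β) := by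
  funext l
  have key : ∀ s t, DB ρ br (W α β) s t = S (fun u v => DB ρ br α s u * β v) t
      + S (fun u v => ((-1 : ℤ) ^ (s.length * u.length)) • (bar α u * DB ρ br β s v)) t := by
    intro s t
    rcases s with _ | ⟨x, _ | ⟨y, _ | ⟨z, s⟩⟩⟩
    · simp [DB, S_zero]
    · simp only [DB, W, bar]
      rw [← S_add]
      refine (S_map ((ρ x : R →ₗ[k] R).toAddMonoidHom) t _).trans ?_
      apply S_congr
      intro u v _
      simp only [LinearMap.toAddMonoidHom_coe, Derivation.coeFn_coe, Derivation.leibniz,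
        smul_eq_mul, List.length_cons, List.length_nil, zero_add, one_mul, smul_mul_assoc,
        smul_smul, ← mul_pow]
      simp; ring
    · simp only [DB, W, bar, S]
      rw [← S_add, ← S_add, ← S_neg]
      apply S_congr
      intro u v _
      simp only [List.length_cons, List.length_nil, zero_add, Nat.reduceAdd, pow_mul,
        even_two, Even.neg_pow, one_pow, one_smul, smul_mul_assoc, mul_neg, smul_neg, neg_mul]
      abel
    · simp [DB, S_zero]
  simp only [Pi.add_apply]
  unfold DD
  rw [S_congr l _ _ (fun s t _ => key s t), S_add]
  congr 1
  · rw [S_assoc]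
    apply S_congr
    intro p v _
    exact (S_map (AddMonoidHom.mulRight (β v)) p _).symm
  · rw [S_assoc]
    trans S (fun p v => S (fun u s => bar α u * DB ρ br β s v) p) l
    · apply S_congr
      intro p v _
      rw [S_comm]
      apply S_congr
      intro u s _
      rw [smul_smul, ← mul_pow]; simp
    · rw [← S_assoc]
      apply S_congr
      intro u q _
      exact (S_map (AddMonoidHom.mulLeft (bar α u)) q _).symm

theorem DDDD_W (α β : List E → R) :
    DD ρ br (DD ρ br (W α β)) = W (DD ρ br (DD ρ br α)) β + W α (DD ρ br (DD ρ br β)) := by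
  rw [DD_W, DD_add, DD_W, DD_W, bar_bar, DD_bar, W_neg_left]
  abel

/-- unit -/
def one : List E → R
  | [] => 1
  | _ => 0

theorem one_W (β : List E → R) : W one β = β := by
  have : ∀ (l : List E) (β : List E → R), S (fun s t => one s * β t) l = β l := by
    intro l
    induction l with
    | nil => intro β; simp [S, one]
    | cons x l ih =>
      intro β
      simp only [S]
      rw [S_congr l (fun s t => one (x :: s) * β t) (fun _ _ => 0)
        (fun s t _ => by simp [one]), S_zero, zero_add, ← ih (fun t => β (x :: t))]
      apply S_congr
      intro s t _
      rcases s with _ | ⟨y, s⟩ <;> simp [one]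
  funext l
  exact this l β

theorem DD_one : DD ρ br (one : List E → R) = 0 := by
  funext l
  rw [DD, S_congr l _ (fun _ _ => 0), S_zero]; rfl
  intro s t _
  rcases s with _ | ⟨x, _ | ⟨y, _ | ⟨z, s⟩⟩⟩ <;> rcases t with _ | ⟨u, t⟩ <;> simp [DB, one]

theorem DD_zero : DD ρ br (0 : List E → R) = 0 := by
  funext l
  rw [DD, S_congr l _ (fun _ _ => 0), S_zero]; rfl
  intro s t _
  rcases s with _ | ⟨x, _ | ⟨y, _ | ⟨z, s⟩⟩⟩ <;> simp [DB]

def MW : List (List E → R) → List E → R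
  | [] => one
  | a :: as => W a (MW as)

theorem W_sum_right (α : List E → R) {ι : Type*} (s : Finset ι) (f : ι → List E → R) :
    W α (∑ i ∈ s, f i) = ∑ i ∈ s, W α (f i) := by
  classical
  induction s using Finset.induction_on with
  | empty => simp [W_zero_right]
  | insert a s ha ih => rw [Finset.sum_insert ha, Finset.sum_insert ha, W_add_right, ih]

theorem main_list (as : List (List E → R)) :
    DD ρ br (DD ρ br (MW as)) = ∑ i : Fin as.length,
      W (MW (as.take i)) (W (DD ρ br (DD ρ br (as.get i))) (MW (as.drop (i + 1)))) := by
  induction as with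
  | nil => simp [MW, DD_one, DD_zero]
  | cons a as ih =>
    simp only [MW]
    rw [DDDD_W, ih, W_sum_right]
    refine Eq.trans ?_ (Fin.sum_univ_succ (n := as.length) _).symm
    congr 1
    · simp [MW, one_W]
    · apply Finset.sum_congr rfl
      intro i _
      simp [MW, W_assoc]

/-- extend a form on tuples to lists by zero -/
def L (p : ℕ) (ω : (Fin p → E) → R) (l : List E) : R :=
  if h : l.length = p then ω (fun i => l.get (Fin.cast h.symm i)) else 0

theorem L_ofFn (p : ℕ) (ω : (Fin p → E) → R) (ψ : Fin p → E) : L p ω (List.ofFn ψ) = ω ψ := by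
  simp [L]

theorem L_ne (p : ℕ) (ω : (Fin p → E) → R) (l : List E) (h : l.length ≠ p) : L p ω l = 0 := by
  simp [L, h]

theorem ext_L (p : ℕ) (f g : List E → R) (h0 : ∀ l, l.length ≠ p → f l = 0)
    (h0' : ∀ l, l.length ≠ p → g l = 0)
    (h : ∀ ψ : Fin p → E, f (List.ofFn ψ) = g (List.ofFn ψ)) : f = g := by
  funext l
  by_cases hl : l.length = p
  · subst hl
    have := h l.get
    rwa [List.ofFn_get] at this
  · rw [h0 l hl, h0' l hl]

end

section
variable {E M : Type*} [AddCommGroup M]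

def sub {n : ℕ} (ψ : Fin n → E) (s : Finset (Fin n)) : List E :=
  ((List.finRange n).filter (· ∈ s)).map ψ

def sg {n : ℕ} (s : Finset (Fin n)) : ℤ :=
  (-1 : ℤ) ^ (∑ i ∈ s, (i : ℕ)) * (-1 : ℤ) ^ (s.card * (s.card - 1) / 2)

theorem filter_eq {n : ℕ} (s : Finset (Fin n)) (p : ℕ) (h : s.card = p) :
    (List.finRange n).filter (· ∈ s) = List.ofFn (fun a : Fin p => (s.orderIsoOfFin h a : Fin n)) := by
  apply List.Perm.eq_of_pairwise (le := (· < ·))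
  · intro a b _ _ h1 h2; exact absurd h1 (lt_asymm h2)
  · exact (List.pairwise_lt_finRange n).filter _
  · rw [List.pairwise_ofFn]
    intro i j hij
    simpa using hij
  · apply (List.perm_ext_iff_of_nodup _ _).2
    · intro a
      simp only [List.mem_filter, List.mem_finRange, true_and, decide_eq_true_eq,
        List.mem_ofFn]
      constructor
      · intro ha
        exact ⟨(s.orderIsoOfFin h).symm ⟨a, ha⟩, by simp⟩
      · rintro ⟨i, rfl⟩; exact (s.orderIsoOfFin h i).2
    · exact (List.nodup_finRange n).filter _
    · rw [List.nodup_ofFn]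
      intro i j hij
      simpa using hij

theorem sub_eq {n : ℕ} (ψ : Fin n → E) (s : Finset (Fin n)) (p : ℕ) (h : s.card = p) :
    sub ψ s = List.ofFn (fun a : Fin p => ψ (s.orderIsoOfFin h a)) := by
  rw [sub, filter_eq s p h, List.map_ofFn]; rfl

theorem length_sub {n : ℕ} (ψ : Fin n → E) (s : Finset (Fin n)) : (sub ψ s).length = s.card := by
  rw [sub_eq ψ s _ rfl]; simp

/-- sets without / with zero -/
def up {n : ℕ} (s : Finset (Fin n)) : Finset (Fin (n + 1)) := s.map (Fin.succEmb n)

theorem zero_notMem_up {n : ℕ} (s : Finset (Fin n)) : (0 : Fin (n+1)) ∉ up s := by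
  simp [up]

theorem sum_finset_succ {n : ℕ} (f : Finset (Fin (n + 1)) → M) :
    ∑ s, f s = ∑ s, f (insert 0 (up s)) + ∑ s : Finset (Fin n), f (up s) := by
  have hu : (Finset.univ : Finset (Fin (n+1))) = insert 0 (up Finset.univ) := by
    ext i; refine Fin.cases ?_ (fun j => ?_) i <;> simp [up]
  rw [← Finset.powerset_univ, hu, Finset.sum_powerset_insert (zero_notMem_up _), add_comm]
  have hp : (up (Finset.univ : Finset (Fin n))).powerset
      = (Finset.univ : Finset (Finset (Fin n))).map
        ⟨up, Finset.map_injective (Fin.succEmb n)⟩ := by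
    ext t
    simp only [Finset.mem_powerset, Finset.mem_map, Finset.mem_univ, true_and,
      Function.Embedding.coeFn_mk]
    rw [up, Finset.subset_map_iff]
    constructor
    · rintro ⟨u, _, rfl⟩; exact ⟨u, rfl⟩
    · rintro ⟨u, rfl⟩; exact ⟨u, Finset.subset_univ _, rfl⟩
  rw [hp, Finset.sum_map, Finset.sum_map]; rfl

theorem sub_up {n : ℕ} (ψ : Fin (n+1) → E) (s : Finset (Fin n)) :
    sub ψ (up s) = sub (fun i => ψ i.succ) s := by
  simp [sub, List.finRange_succ, up, List.filter_map, Function.comp_def]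

theorem sub_insert {n : ℕ} (ψ : Fin (n+1) → E) (s : Finset (Fin n)) :
    sub ψ (insert 0 (up s)) = ψ 0 :: sub (fun i => ψ i.succ) s := by
  simp [sub, List.finRange_succ, up, List.filter_map, Function.comp_def]

theorem compl_up {n : ℕ} (s : Finset (Fin n)) : (up s)ᶜ = insert 0 (up sᶜ) := by
  ext i; refine Fin.cases ?_ (fun j => ?_) i <;> simp [up]

theorem compl_insert' {n : ℕ} (s : Finset (Fin n)) : (insert 0 (up s))ᶜ = up sᶜ := by
  ext i; refine Fin.cases ?_ (fun j => ?_) i <;> simp [up]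

theorem card_up {n : ℕ} (s : Finset (Fin n)) : (up s).card = s.card := by simp [up]

theorem sum_up {n : ℕ} (s : Finset (Fin n)) :
    ∑ i ∈ up s, (i : ℕ) = ∑ i ∈ s, (i : ℕ) + s.card := by
  simp [up, Finset.sum_add_distrib]

theorem sg_up {n : ℕ} (s : Finset (Fin n)) : sg (up s) = sg s * (-1) ^ s.card := by
  rw [sg, sg, card_up, sum_up, pow_add]; ring

theorem sg_insert {n : ℕ} (s : Finset (Fin n)) : sg (insert 0 (up s)) = sg s := by
  rw [sg, sg, Finset.sum_insert (zero_notMem_up s), Finset.card_insert_of_notMem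
    (zero_notMem_up s), card_up, sum_up]
  have : (s.card + 1) * (s.card + 1 - 1) / 2 = s.card * (s.card - 1) / 2 + s.card := by
    rw [← Nat.triangle_succ]
  rw [this]
  simp only [Fin.val_zero, zero_add, pow_add]
  have h : ((-1 : ℤ) ^ s.card) * (-1) ^ s.card = 1 := by rw [← mul_pow]; simp
  linear_combination ((-1 : ℤ) ^ (∑ i ∈ s, (i : ℕ)) * (-1 : ℤ) ^ (s.card * (s.card - 1) / 2)) * h

theorem S_ofFn {n : ℕ} : ∀ (ψ : Fin n → E) (B : List E → List E → M),
    S B (List.ofFn ψ) = ∑ s : Finset (Fin n), sg s • B (sub ψ s) (sub ψ sᶜ) := by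
  induction n with
  | zero =>
    intro ψ B
    rw [Fintype.sum_eq_single (∅ : Finset (Fin 0))
      (fun s hs => absurd (Subsingleton.elim s ∅) hs)]
    simp [S, sg, sub]
  | succ n ih =>
    intro ψ B
    rw [List.ofFn_succ, S, ih, ih, sum_finset_succ]
    congr 1
    · simp only [compl_insert', sub_insert, sub_up, sg_insert]
    · simp only [compl_up, sub_insert, sub_up, sg_up, length_sub, mul_smul]

theorem S_nil (l : List E) : ∀ (B : List E → List E → M),
    (∀ s t, s ≠ [] → B s t = 0) → S B l = B [] l := by
  induction l with
  | nil => intro B _; rfl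
  | cons x l ih =>
    intro B h
    rw [S, S_congr l _ (fun _ _ => 0) (fun s t _ => h (x :: s) t (by simp)), S_zero, ih]
    · simp
    · intro s t hs; rw [h s _ hs, smul_zero]

theorem S_one {n : ℕ} : ∀ (ψ : Fin (n + 1) → E) (B : List E → List E → M),
    (∀ s t, s.length ≠ 1 → B s t = 0) → S B (List.ofFn ψ) =
      ∑ i : Fin (n + 1), ((-1 : ℤ) ^ (i : ℕ)) • B [ψ i] (List.ofFn (i.removeNth ψ)) := by
  induction n with
  | zero =>
    intro ψ B h
    simp [S, h [] _]
  | succ n ih =>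
    intro ψ B h
    rw [List.ofFn_succ, S, S_nil, ih, Fin.sum_univ_succ (n := n + 1)]
    · congr 1
      · simp [Fin.removeNth_zero, Fin.tail_def]
      · apply Finset.sum_congr rfl
        intro i _
        rw [smul_smul]
        congr 1
        · simp [pow_succ]
        · congr 1
          conv_rhs => rw [List.ofFn_succ]
          simp [Fin.removeNth]
          rfl
    · intro s t hs; rw [h s _ hs, smul_zero]
    · intro s t hs; apply h; simpa using hs

theorem S_two {n : ℕ} : ∀ (ψ : Fin (n + 2) → E) (B : List E → List E → M),
    (∀ s t, s.length ≠ 2 → B s t = 0) → S B (List.ofFn ψ) =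
      ∑ i : Fin (n + 2), ∑ j : Fin (n + 2),
          if h : i < j then
            ((-1 : ℤ) ^ ((i : ℕ) + (j : ℕ))) •
              (- B [ψ i, ψ j] (List.ofFn (fun l : Fin n =>
                  ψ (j.succAbove
                    ((⟨(i : ℕ), lt_of_lt_of_le (Fin.lt_def.mp h)
                        (Nat.lt_succ_iff.mp j.isLt)⟩ : Fin (n + 1)).succAbove l)))))
          else 0 := by
  induction n with
  | zero =>
    intro ψ B h
    simp [S, h [] _, h [_] _, Fin.sum_univ_two]
  | succ n ih =>
    intro ψ B h
    rw [List.ofFn_succ, S, S_one, ih, Fin.sum_univ_succ (n := n + 2)]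
    · congr 1
      · rw [Fin.sum_univ_succ (n := n + 2)]
        simp only [lt_self_iff_false, dite_false, zero_add]
        apply Finset.sum_congr rfl
        intro j _
        rw [dif_pos (Fin.succ_pos j), smul_neg, ← neg_smul]
        congr 1
        · simp [pow_succ]
        · congr 1
          congr 1
          funext l
          change ψ (j.succAbove l).succ = ψ (j.succ.succAbove ((0 : Fin (n + 2)).succAbove l))
          rw [Fin.zero_succAbove, Fin.succ_succAbove_succ]
      · apply Finset.sum_congr rfl
        intro i _
        rw [Fin.sum_univ_succ (n := n + 2)]
        simp only [Fin.not_lt_zero, dite_false, zero_add, Fin.succ_lt_succ_iff]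
        apply Finset.sum_congr rfl
        intro j _
        split_ifs with hij
        · congr 1
          · simp only [Fin.val_succ]; ring
          · simp only [List.length_cons, List.length_nil]
            norm_num
            congr 1
            refine congrArg (fun t => ψ 0 :: t) ?_
            congr 1
            funext l
            have hi : (i : ℕ) < n + 1 := by have := Fin.lt_def.mp hij; omega
            change _ = ψ (j.succ.succAbove ((⟨(i : ℕ), hi⟩ : Fin (n + 1)).succ.succAbove l.succ))
            rw [Fin.succ_succAbove_succ, Fin.succ_succAbove_succ]
        · rfl
    · intro s t hs; rw [h s _ hs, smul_zero]
    · intro s t hs; apply h; simpa using hs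

end

section
variable {k R E : Type*} [Field k] [CommRing R] [Algebra k R]
  [AddCommGroup E] [Module k E] [Module R E] [IsScalarTower k R E]
variable (ρ : E →ₗ[R] Derivation k R R) (br : E → E → E)

theorem L_wedge (p q : ℕ) (α : (Fin p → E) → R) (β : (Fin q → E) → R) :
    L (p + q) (wedgeForm p q α β) = W (L p α) (L q β) := by
  apply ext_L (p + q)
  · intro l hl; exact L_ne _ _ _ hl
  · intro l hl
    rw [W, S_congr l _ (fun _ _ => 0), S_zero]
    intro s t hst
    by_cases hs : s.length = p
    · rw [L_ne q β t (by omega), mul_zero]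
    · rw [L_ne p α s hs, zero_mul]
  · intro ψ
    rw [L_ofFn, W, S_ofFn, wedgeForm]
    apply Finset.sum_congr rfl
    intro s _
    split_ifs with h
    · have hc : sᶜ.card = q := by rw [Finset.card_compl, h, Fintype.card_fin]; omega
      rw [sub_eq ψ s p h, sub_eq ψ sᶜ q hc, L_ofFn, L_ofFn, sg, h]
    · rw [L_ne p α _ (by rwa [length_sub]), zero_mul, smul_zero]

theorem L_ceDiff (p : ℕ) (ω : (Fin p → E) → R) :
    L (p + 1) (ceDiff ρ br p ω) = DD ρ br (L p ω) := by
  apply ext_L (p + 1)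
  · intro l hl; exact L_ne _ _ _ hl
  · intro l hl
    rw [DD, S_congr l _ (fun _ _ => 0), S_zero]
    intro s t hst
    rcases s with _ | ⟨x, _ | ⟨y, _ | ⟨z, s⟩⟩⟩
    · rfl
    · simp only [List.length_cons, List.length_nil] at hst
      simp only [DB]; rw [L_ne _ _ _ (by omega), map_zero]
    · simp only [List.length_cons, List.length_nil] at hst
      simp only [DB]; rw [L_ne _ _ _ (by simp; omega), neg_zero]
    · rfl
  · intro ψ
    rw [L_ofFn, DD]
    have hB : ∀ s t, DB ρ br (L p ω) s t = (if s.length = 1 then DB ρ br (L p ω) s t else 0)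
        + (if s.length = 2 then DB ρ br (L p ω) s t else 0) := by
      intro s t
      rcases s with _ | ⟨x, _ | ⟨y, _ | ⟨z, s⟩⟩⟩ <;> simp [DB]
    rw [S_congr _ _ _ (fun s t _ => hB s t), S_add, S_one]
    · cases p with
      | zero =>
        rw [S_congr (List.ofFn ψ) (fun s t => if s.length = 2 then DB ρ br (L 0 ω) s t else 0)
          (fun _ _ => 0), S_zero, add_zero]
        · simp only [ceDiff]
          apply Finset.sum_congr rfl
          intro i _
          simp only [List.length_cons, List.length_nil, zero_add, if_true, DB, L_ofFn]
        · intro s t hst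
          rw [if_neg]
          simp at hst; omega
      | succ q =>
        rw [S_two]
        · simp only [ceDiff]
          congr 1
          · apply Finset.sum_congr rfl
            intro i _
            simp only [List.length_cons, List.length_nil, zero_add, if_true, DB, L_ofFn]
          · apply Finset.sum_congr rfl
            intro i _
            apply Finset.sum_congr rfl
            intro j _
            split_ifs with hij
            · simp only [List.length_cons, List.length_nil, zero_add, if_true, DB, neg_neg]
              rw [← L_ofFn (q + 1) ω, List.ofFn_cons]
            · simp at *
            · rfl
        · intro s t hs; rw [if_neg hs]
    · intro s t hs; rw [if_neg hs]

theorem ofFn_cast {a b : ℕ} (h : a = b) (ψ : Fin b → E) :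
    List.ofFn (fun l : Fin a => ψ (Fin.cast h l)) = List.ofFn ψ := by
  subst h; rfl

theorem L_cast {a b : ℕ} (h : a = b) (ω : (Fin a → E) → R) :
    L b (fun ψ => ω (fun l => ψ (Fin.cast h l))) = L a ω := by
  subst h; rfl

theorem L_multi (n : ℕ) : ∀ (αs : Fin n → (E →ₗ[R] R)),
    L n (multiWedge n αs) = MW (List.ofFn (fun i => L 1 (oneForm (αs i)))) := by
  induction n with
  | zero =>
    intro αs
    funext l
    rcases l with _ | ⟨x, l⟩ <;> simp [L, MW, one, multiWedge]
  | succ m ih =>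
    intro αs
    rw [List.ofFn_succ, MW, ← ih, ← L_wedge]
    exact L_cast (Nat.add_comm 1 m) (wedgeForm 1 m (oneForm (αs 0)) (multiWedge m (fun i => αs i.succ)))

end

end CEAux

/-- for an anchored almost Lie algebroid `(E,ρ,[.,.])` over a commutative
`k`-algebra `R` and `E`-1-forms `α₁,…,α_k`, the square of the differential `D` acts as a
derivation without signs on wedge products:
`D(D(α₁∧⋯∧α_k)) = Σᵢ α₁∧⋯∧α_{i−1}∧D(D(αᵢ))∧α_{i+1}∧⋯∧α_k`. -/
theorem ceDiff_squared_wedge_derivation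
    {k R E : Type*} [Field k] [CommRing R] [Algebra k R]
    [AddCommGroup E] [Module k E] [Module R E] [IsScalarTower k R E]
    (ρ : E →ₗ[R] Derivation k R R)
    (br : E → E → E)
    (br_add_left : ∀ φ₁ φ₂ ψ : E, br (φ₁ + φ₂) ψ = br φ₁ ψ + br φ₂ ψ)
    (br_smul_left : ∀ (a : k) (φ ψ : E), br (a • φ) ψ = a • br φ ψ)
    (br_skew : ∀ φ ψ : E, br φ ψ = - br ψ φ)
    (leibniz : ∀ (φ : E) (f : R) (ψ : E), br φ (f • ψ) = ρ φ f • ψ + f • br φ ψ)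
    (anchor_br : ∀ φ ψ : E, ρ (br φ ψ) = ⁅ρ φ, ρ ψ⁆)
    (n : ℕ) (αs : Fin n → (E →ₗ[R] R)) :
    ∀ ψ : Fin (n + 2) → E,
      ceDiff ρ br (n + 1) (ceDiff ρ br n (multiWedge n αs)) ψ =
        ∑ i : Fin n,
          -- the term α₁ ∧ ⋯ ∧ α_{i−1} ∧ D(D(αᵢ)) ∧ α_{i+1} ∧ ⋯ ∧ α_n,
          -- grouped as (α₁∧⋯∧α_{i−1}) ∧ (D(D(αᵢ)) ∧ (α_{i+1}∧⋯∧α_n))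
          wedgeForm (i : ℕ) (3 + (n - (i : ℕ) - 1))
            (multiWedge (i : ℕ) (fun j => αs ⟨(j : ℕ), by omega⟩))
            (wedgeForm 3 (n - (i : ℕ) - 1)
              (ceDiff ρ br 2 (ceDiff ρ br 1 (oneForm (αs i))))
              (multiWedge (n - (i : ℕ) - 1)
                (fun j => αs ⟨(i : ℕ) + 1 + (j : ℕ), by omega⟩)))
            (fun l => ψ (Fin.cast (by omega) l)) := by
  intro ψ
  have key := CEAux.main_list ρ br (List.ofFn (fun i => CEAux.L 1 (oneForm (αs i))))
  rw [← CEAux.L_multi, ← CEAux.L_ceDiff, ← CEAux.L_ceDiff] at key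
  have key2 := congrFun key (List.ofFn ψ)
  rw [CEAux.L_ofFn] at key2
  rw [key2, Finset.sum_apply]
  have hlen : (List.ofFn (fun i => CEAux.L 1 (oneForm (αs i)))).length = n := by simp
  refine Fintype.sum_equiv (finCongr hlen) _ _ ?_
  intro i
  have hi : (i : ℕ) < n := lt_of_lt_of_eq i.2 hlen
  rw [← CEAux.L_ofFn _ (wedgeForm _ _ _ _), CEAux.L_wedge, CEAux.L_wedge, CEAux.L_multi,
    CEAux.L_multi, CEAux.L_ceDiff, CEAux.L_ceDiff, CEAux.ofFn_cast]
  congr 2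
  · congr 1
    apply List.ext_getElem
    · simp; omega
    · intro j h1 h2
      simp
  · congr 1
    · simp
      rfl
  · congr 1
    · apply List.ext_getElem
      · simp; omega
      · intro j h1 h2
        simp
end
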